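/- Let k > 0 and z > 0. (i) If z ≤ k and, for every integer j, |z − (j + 1/2)π| ≥ (π/8)/(1 + 2z/π), then [k² + (k² − z²)·(sin(2z)/(2z))] / cos²(z) ≤ 86·max{k⁴, 1}. (ii) If k ≥ 1 or z ≥ √(π²/4 − 1), then [(2z² + k²)·sinh(2z) + 2k²z] / [2z·√(z² + k²)·(cosh(2z) + 1)] ≤ 3·max{k, 1}. -/

import Mathlib

open scoped Real

/-- A quantitative lower bound for `|cos|` away from its zeros (Jordan's inequality). -/
theorem le_abs_cos_of_forall_le_abs_sub {z ε : ℝ}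
    (h : ∀ j : ℤ, ε ≤ |z - ((j : ℝ) + 1 / 2) * π|) : 2 / π * ε ≤ |Real.cos z| := by
  set j := ⌊z / π⌋ with hj
  have hπ := Real.pi_pos
  have h1 : (j : ℝ) * π ≤ z := (le_div_iff₀ hπ).1 (Int.floor_le (z / π))
  have h2 : z < ((j : ℝ) + 1) * π := (div_lt_iff₀ hπ).1 (Int.lt_floor_add_one (z / π))
  set w := z - ((j : ℝ) + 1 / 2) * π with hw
  have hw' : |w| ≤ π / 2 := abs_le.2 ⟨by linarith, by linarith⟩
  have hcos : |Real.cos z| = |Real.sin w| := by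
    have : z = w + π / 2 + j * π := by rw [hw]; ring
    rw [this, Real.cos_add_int_mul_pi, Real.cos_add_pi_div_two, abs_mul, abs_neg,
      abs_zpow]
    simp
  rw [hcos]
  exact (mul_le_mul_of_nonneg_left (h j) (by positivity)).trans (Real.mul_abs_le_abs_sin hw')

theorem sinh_le_mul_cosh {z : ℝ} (hz : 0 ≤ z) : Real.sinh z ≤ z * Real.cosh z := by
  have hmono : MonotoneOn (fun x => x * Real.cosh x - Real.sinh x) (Set.Ici 0) := by
    have hd (x : ℝ) : HasDerivAt (fun x => x * Real.cosh x - Real.sinh x)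
        (x * Real.sinh x) x := by
      refine (((hasDerivAt_id x).mul (Real.hasDerivAt_cosh x)).sub
        (Real.hasDerivAt_sinh x)).congr_deriv ?_
      simp
    refine monotoneOn_of_deriv_nonneg (convex_Ici 0)
      (fun x _ => (hd x).continuousAt.continuousWithinAt)
      (fun x _ => (hd x).differentiableAt.differentiableWithinAt) fun x hx => ?_
    rw [interior_Ici] at hx
    rw [(hd x).deriv]
    exact mul_nonneg (le_of_lt hx) (Real.sinh_nonneg_iff.2 (le_of_lt hx))
  have := hmono (Set.self_mem_Ici) hz hz
  simpa using this

/-- Per-mode bounds `φ̃ₙ ≤ 86·max{k⁴,1}` (propagating) and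
`(μ̃ₙ²‖Ỹₙ‖² + ‖Ỹₙ'‖²)/μ̃ₙ ≤ 3·max{k,1}` (evanescent) for the lifting with Dirichlet
datum on the bottom side and homogeneous Neumann condition on the top side. -/
theorem stmt_15 (k z : ℝ) (hk : 0 < k) (hz : 0 < z) :
    ((z ≤ k ∧ ∀ j : ℤ, |z - ((j : ℝ) + 1 / 2) * π| ≥ (π / 8) / (1 + 2 * z / π)) →
      (k ^ 2 + (k ^ 2 - z ^ 2) * (Real.sin (2 * z) / (2 * z))) / Real.cos z ^ 2
      ≤ 86 * max (k ^ 4) 1)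
    ∧ ((1 ≤ k ∨ Real.sqrt (π ^ 2 / 4 - 1) ≤ z) →
      ((2 * z ^ 2 + k ^ 2) * Real.sinh (2 * z) + 2 * k ^ 2 * z)
        / (2 * z * Real.sqrt (z ^ 2 + k ^ 2) * (Real.cosh (2 * z) + 1))
      ≤ 3 * max k 1) := by
  constructor
  · rintro ⟨hzk, hdist⟩
    have hπ := Real.pi_pos
    have hcos : 1 / (4 * (1 + 2 * z / π)) ≤ |Real.cos z| := by
      refine le_trans (le_of_eq ?_) (le_abs_cos_of_forall_le_abs_sub hdist)
      field_simp
      norm_num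
    have hcos_pos : 0 < |Real.cos z| := lt_of_lt_of_le (by positivity) hcos
    have hone : 1 ≤ 4 * (1 + 2 * z / π) * |Real.cos z| := by
      rwa [div_le_iff₀ (by positivity), mul_comm] at hcos
    have hnum : k ^ 2 + (k ^ 2 - z ^ 2) * (Real.sin (2 * z) / (2 * z)) ≤ 2 * k ^ 2 := by
      have hs : Real.sin (2 * z) / (2 * z) ≤ 1 :=
        (div_le_one (by positivity)).2 (Real.sin_le (by positivity))
      nlinarith [mul_nonneg (sub_nonneg.2 (pow_le_pow_left₀ hz.le hzk 2)) (sub_nonneg.2 hs),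
        sq_nonneg z]
    have hpi : 2 / π ≤ 0.637 := by
      rw [div_le_iff₀ hπ]
      linarith [Real.pi_gt_d2]
    have hfac : 1 + 2 * z / π ≤ 1 + 0.637 * k := by
      have : 2 * z / π = 2 / π * z := by ring
      rw [this]
      gcongr
    have hpoly : 2 * k ^ 2 * (4 * (1 + 0.637 * k)) ^ 2 ≤ 86 * max (k ^ 4) 1 := by
      rcases le_total k 1 with h | h
      · calc _ ≤ 2 * (1 : ℝ) ^ 2 * (4 * (1 + 0.637 * 1)) ^ 2 := by gcongr
          _ ≤ 86 * 1 := by norm_num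
          _ ≤ _ := by gcongr; exact le_max_right _ _
      · calc _ ≤ 2 * k ^ 2 * (4 * (k + 0.637 * k)) ^ 2 := by gcongr
          _ = 2 * (4 * 1.637) ^ 2 * k ^ 4 := by ring
          _ ≤ 86 * k ^ 4 := by gcongr; norm_num
          _ ≤ _ := by gcongr; exact le_max_left _ _
    rw [← sq_abs (Real.cos z), div_le_iff₀ (by positivity)]
    calc _ ≤ 2 * k ^ 2 * 1 ^ 2 := by linarith
      _ ≤ 2 * k ^ 2 * (4 * (1 + 0.637 * k) * |Real.cos z|) ^ 2 := by
        gcongr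
        exact hone.trans (by gcongr)
      _ = 2 * k ^ 2 * (4 * (1 + 0.637 * k)) ^ 2 * |Real.cos z| ^ 2 := by ring
      _ ≤ _ := by gcongr
  · intro _
    set M := Real.sqrt (z ^ 2 + k ^ 2)
    have hzM : z ≤ M := Real.le_sqrt_of_sq_le (by nlinarith)
    have hkM : k ≤ M := Real.le_sqrt_of_sq_le (by nlinarith)
    have hM : 0 < M := hk.trans_le hkM
    have hC : 2 ≤ Real.cosh (2 * z) + 1 := by linarith [Real.one_le_cosh (2 * z)]
    have hSC : Real.sinh (2 * z) ≤ Real.cosh (2 * z) + 1 := by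
      linarith [Real.sinh_lt_cosh (2 * z)]
    have hSz : Real.sinh (2 * z) ≤ z * (Real.cosh (2 * z) + 1) := by
      rw [Real.sinh_two_mul, Real.cosh_two_mul, Real.sinh_sq]
      nlinarith [mul_le_mul_of_nonneg_right (sinh_le_mul_cosh hz.le) (Real.cosh_pos z).le]
    set C := Real.cosh (2 * z) + 1
    have hmax : 1 + k ≤ 3 * max k 1 := by
      linarith [le_max_left k 1, le_max_right k 1]
    refine le_trans ?_ hmax
    rw [div_le_iff₀ (by positivity)]
    calc _ = 2 * z * z * Real.sinh (2 * z) + k ^ 2 * Real.sinh (2 * z) + k ^ 2 * z * 2 := by ring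
      _ ≤ 2 * z * M * C + k ^ 2 * (z * C) + k ^ 2 * z * C := by gcongr
      _ = 2 * z * M * C + 2 * k * z * k * C := by ring
      _ ≤ 2 * z * M * C + 2 * k * z * M * C := by gcongr
      _ = _ := by ring
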